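/- The sequence 0 → (ℝ⟨⟨X⟩⟩, +) → (G, ⊙) → (M, ⧢) → 1 is a split short exact sequence of groups: the map i : c ↦ (𝟙, c) is an injective group homomorphism from (ℝ⟨⟨X⟩⟩, +) to (G, ⊙); the projection π₁ : (c₁, c₂) ↦ c₁ is a surjective group homomorphism from (G, ⊙) onto the shuffle group (M, ⧢) whose kernel is exactly the image G₊ := i(ℝ⟨⟨X⟩⟩) = {(𝟙, c) : c ∈ ℝ⟨⟨X⟩⟩} (so G₊ is a normal subgroup of (G, ⊙)); and the map s : c₁ ↦ (c₁, 0) is a group homomorphism from (M, ⧢) to (G, ⊙) with π₁ ∘ s = id. Consequently (G, ⊙) is isomorphic to the semidirect product M ⋉ (ℝ⟨⟨X⟩⟩, +). -/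

import Mathlib

open scoped Classical

/-!  Common setup: noncommutative formal power series ℝ⟨⟨X⟩⟩ over the
alphabet X = {x₀, x₁}.  Words are encoded as lists over `Fin 2`
(the letter `0` is x₀ and `1` is x₁); a series is a function from words
to ℝ, recording its coefficients. -/

/-- Words over the alphabet X = {x₀, x₁}. -/
abbrev Word : Type := List (Fin 2)

/-- Noncommutative formal power series ℝ⟨⟨X⟩⟩. -/
abbrev Ser : Type := Word → ℝ

/-- The series 𝟙 (the empty word). -/
def one1 : Ser := fun w => if w = [] then 1 else 0

/-- A single word η regarded as a series. -/
def mono (η : Word) : Ser := fun w => if w = η then 1 else 0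

/-- Left concatenation of a series by the letter `x_i`. -/
def lc (i : Fin 2) (c : Ser) : Ser := fun w =>
  match w with
  | [] => 0
  | j :: u => if j = i then c u else 0

/-- Auxiliary recursion computing the coefficient of a word `w` in `c ⧢ d`:
`(c ⧢ d)(𝟙) = c(𝟙) d(𝟙)` and
`(c ⧢ d)(x_i w) = ((x_i⁻¹ c) ⧢ d)(w) + (c ⧢ (x_i⁻¹ d))(w)`,
where `x_i⁻¹` is the left shift.  This dual recursion is exactly the
bilinear extension of the inductive shuffle of words
`(x_i ξ) ⧢ (x_j η) = x_i (ξ ⧢ x_j η) + x_j (x_i ξ ⧢ η)`, `𝟙 ⧢ η = η ⧢ 𝟙 = η`. -/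
def shAux : Word → Ser → Ser → ℝ
  | [], c, d => c [] * d []
  | i :: w, c, d => shAux w (fun u => c (i :: u)) d + shAux w c (fun u => d (i :: u))

/-- The shuffle product `⧢` on ℝ⟨⟨X⟩⟩. -/
def sh (c d : Ser) : Ser := fun w => shAux w c d

/-- Shuffle powers `c^{⧢ k}`. -/
def shPow (c : Ser) : ℕ → Ser
  | 0 => one1
  | k + 1 => sh c (shPow c k)

/-- The shuffle inverse `c^{⧢ -1} = Σ_{k ≥ 0} (𝟙 - c)^{⧢ k}`.
When `c(𝟙) = 1` the sum is locally finite (for each word only finitely many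
terms are nonzero) and `∑'` returns it. -/
noncomputable def shInv (c : Ser) : Ser := fun w => ∑' k : ℕ, shPow (one1 - c) k w

/-- Composition product restricted to words: `𝟙 ∘ d = 𝟙`,
`(x₀ η) ∘ d = x₀ (η ∘ d)`, `(x₁ η) ∘ d = x₀ (d ⧢ (η ∘ d))`. -/
def wordComp : Word → Ser → Ser
  | [], _ => one1
  | i :: η, d => if i = 0 then lc 0 (wordComp η d) else lc 0 (sh d (wordComp η d))

/-- The composition product `c ∘ d = Σ_η c(η) (η ∘ d)`.  For each fixed word
only finitely many terms are nonzero, and `∑'` returns the sum. -/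
noncomputable def comp (c d : Ser) : Ser := fun w => ∑' η : Word, c η * wordComp η d w

/-- Membership in the set `G`: pairs `(d₁, d₂)` with `d₁(𝟙) = 1`. -/
def inG (d : Ser × Ser) : Prop := d.1 [] = 1

/-- Mixed composition product restricted to words: `𝟙 ◁ d = 𝟙`,
`(x₀ η) ◁ d = x₀ (η ◁ d)`,
`(x₁ η) ◁ d = x₁ (d₁ ⧢ (η ◁ d)) + x₀ (d₂ ⧢ (η ◁ d))`. -/
def wordMComp : Word → Ser × Ser → Ser
  | [], _ => one1
  | i :: η, d =>
      if i = 0 then lc 0 (wordMComp η d)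
      else lc 1 (sh d.1 (wordMComp η d)) + lc 0 (sh d.2 (wordMComp η d))

/-- The mixed composition product `c ◁ d = Σ_η c(η) (η ◁ d)`. -/
noncomputable def mcomp (c : Ser) (d : Ser × Ser) : Ser :=
  fun w => ∑' η : Word, c η * wordMComp η d w

/-- Componentwise mixed composition `c ⊲ d = (c₁ ◁ d, c₂ ◁ d)`. -/
noncomputable def tri (c d : Ser × Ser) : Ser × Ser := (mcomp c.1 d, mcomp c.2 d)

/-- Componentwise composition `d ∘̄ c = (d₁ ∘ c, d₂ ∘ c)`. -/
noncomputable def bcomp (d : Ser × Ser) (c : Ser) : Ser × Ser := (comp d.1 c, comp d.2 c)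

/-- The group product `⊙` on `G`:
`(c₁, c₂) ⊙ (d₁, d₂) = (c₁ ⧢ d₁, c₂ + d₂ ⧢ c₁)`. -/
def odot (c d : Ser × Ser) : Ser × Ser := (sh c.1 d.1, c.2 + sh d.2 c.1)

/-- The identity element `e = (𝟙, 0)`. -/
def eG : Ser × Ser := (one1, 0)

/-- The `⊙`-inverse `c^{⊙ -1} = (c₁^{⧢ -1}, -(c₁^{⧢ -1} ⧢ c₂))`. -/
noncomputable def odotInv (c : Ser × Ser) : Ser × Ser :=
  (shInv c.1, -(sh (shInv c.1) c.2))

/-- The affine feedback group product `c ⋆ d = (c ⊲ d) ⊙ d` on `G`. -/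
noncomputable def star (c d : Ser × Ser) : Ser × Ser := odot (tri c d) d

/-- The `⋆`-inverse of an element of `G` (defined via choice; for an element
of the group `(G, ⋆)` it is the unique two-sided `⋆`-inverse). -/
noncomputable def starInv (x : Ser × Ser) : Ser × Ser :=
  if h : ∃ y : Ser × Ser, inG y ∧ star x y = eG ∧ star y x = eG then h.choose else x

/-- The affine feedback product `c @ d = c ◁ ((d^{⊙ -1}) ∘̄ c)^{⋆ -1}`. -/
noncomputable def atp (c : Ser) (d : Ser × Ser) : Ser :=
  mcomp c (starInv (bcomp (odotInv d) c))

/-- Membership in ℝ[[x₀]]: series vanishing on every word containing x₁. -/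
def inRx0 (c : Ser) : Prop := ∀ w : Word, (1 : Fin 2) ∈ w → c w = 0

/-- Membership in the shuffle group `M = {c : c(𝟙) = 1}`. -/
def inM (c : Ser) : Prop := c [] = 1

/-- The monomorphism `i : c ↦ (𝟙, c)` from `(ℝ⟨⟨X⟩⟩, +)` into `(G, ⊙)`. -/
def iMap (c : Ser) : Ser × Ser := (one1, c)

/-- The projection `π₁ : (c₁, c₂) ↦ c₁` onto the first component. -/
def pi1 (g : Ser × Ser) : Ser := g.1

/-- The section `s : c₁ ↦ (c₁, 0)` of `π₁`. -/
def sMap (c : Ser) : Ser × Ser := (c, 0)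

theorem sh_nil (c d : Ser) : sh c d [] = c [] * d [] := rfl

theorem sh_cons (c d : Ser) (i : Fin 2) (w : Word) :
    sh c d (i :: w) = sh (fun u => c (i :: u)) d w + sh c (fun u => d (i :: u)) w := rfl

theorem sh_comm (c d : Ser) : sh c d = sh d c := by
  funext w
  induction w generalizing c d with
  | nil => exact mul_comm _ _
  | cons i w ih => rw [sh_cons, sh_cons, ih, ih c, add_comm]

theorem sh_add (c d e : Ser) : sh c (d + e) = sh c d + sh c e := by
  funext w
  induction w generalizing c d e with
  | nil => exact mul_add _ _ _
  | cons i w ih =>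
    have h₁ := ih (fun u => c (i :: u)) d e
    have h₂ := ih c (fun u => d (i :: u)) (fun u => e (i :: u))
    simp only [Pi.add_apply] at h₁ h₂ ⊢
    simp only [sh_cons, h₁]
    linear_combination h₂

theorem add_sh (c d e : Ser) : sh (c + d) e = sh c e + sh d e := by
  rw [sh_comm, sh_add, sh_comm e c, sh_comm e d]

theorem sh_assoc (c d e : Ser) : sh (sh c d) e = sh c (sh d e) := by
  funext w
  induction w generalizing c d e with
  | nil => exact mul_assoc _ _ _
  | cons i w ih =>
    have shift (a b : Ser) : (fun u => sh a b (i :: u)) =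
        sh (fun u => a (i :: u)) b + sh a (fun u => b (i :: u)) := rfl
    rw [sh_cons (sh c d), sh_cons c, shift, shift, add_sh, sh_add, Pi.add_apply, Pi.add_apply,
      ih, ih, ih, add_assoc]

/-- The shuffle product by a fixed series, as an additive homomorphism. -/
def shHom (c : Ser) : Ser →+ Ser := AddMonoidHom.mk' (sh c) (sh_add c)

theorem sh_zero (c : Ser) : sh c 0 = 0 := map_zero (shHom c)

theorem zero_sh (c : Ser) : sh 0 c = 0 := by rw [sh_comm, sh_zero]

theorem sh_one1 (c : Ser) : sh c one1 = c := by
  funext w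
  induction w generalizing c with
  | nil => simp [sh_nil, one1]
  | cons i w ih =>
    have h : (fun u => one1 (i :: u)) = 0 := by funext u; simp [one1]
    rw [sh_cons, h, sh_zero, ih]
    simp

theorem one1_sh (c : Ser) : sh one1 c = c := by rw [sh_comm, sh_one1]

/-- A coefficient of a shuffle product only depends on coefficients of words which are no
longer. -/
theorem sh_congr {c d e : Ser} {w : Word}
    (h : ∀ u : Word, u.length ≤ w.length → d u = e u) : sh c d w = sh c e w := by
  induction w generalizing c d e with
  | nil => simp [sh_nil, h [] le_rfl]
  | cons i w ih =>
    rw [sh_cons, sh_cons, ih fun u hu => h u (hu.trans (Nat.le_succ _)),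
      ih fun u hu => h (i :: u) (Nat.succ_le_succ hu)]

/-- The shuffle product is additive in degree with respect to the order of vanishing. -/
theorem sh_eq_zero {c d : Ser} {m n : ℕ} (hc : ∀ u : Word, u.length < m → c u = 0)
    (hd : ∀ u : Word, u.length < n → d u = 0) {w : Word} (hw : w.length < m + n) :
    sh c d w = 0 := by
  induction w generalizing c d m n with
  | nil =>
    rw [sh_nil]
    rcases Nat.eq_zero_or_pos m with rfl | hm
    · rw [hd [] (by simpa using hw), mul_zero]
    · rw [hc [] hm, zero_mul]
  | cons i w ih =>
    rw [List.length_cons] at hw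
    rw [sh_cons,
      ih (m := m - 1) (fun u hu => hc (i :: u) (by rw [List.length_cons]; omega)) hd (by omega),
      ih (n := n - 1) hc (fun u hu => hd (i :: u) (by rw [List.length_cons]; omega)) (by omega),
      add_zero]

theorem shPow_eq_zero {c : Ser} (hc : c [] = 0) (k : ℕ) {w : Word} (hw : w.length < k) :
    shPow c k w = 0 := by
  induction k generalizing w with
  | zero => exact absurd hw (Nat.not_lt_zero _)
  | succ k ih =>
    refine sh_eq_zero (m := 1) (fun u hu => ?_) (fun u hu => ih hu) (by omega)
    rwa [List.eq_nil_of_length_eq_zero (by omega : u.length = 0)]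

theorem shInv_eq_sum {c : Ser} (hc : inM c) {n : ℕ} {w : Word} (hw : w.length < n) :
    shInv c w = (∑ k ∈ Finset.range n, shPow (one1 - c) k) w := by
  have h0 : (one1 - c) [] = 0 := by rw [Pi.sub_apply, hc]; simp [one1]
  rw [Finset.sum_apply]
  refine tsum_eq_sum fun k hk => shPow_eq_zero h0 k ?_
  rw [Finset.mem_range] at hk
  omega

theorem sh_sum_shPow (c : Ser) (n : ℕ) :
    sh c (∑ k ∈ Finset.range n, shPow (one1 - c) k) = one1 - shPow (one1 - c) n := by
  induction n with
  | zero => simp [sh_zero, shPow]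
  | succ n ih =>
    have h : shPow (one1 - c) n = shPow (one1 - c) (n + 1) + sh c (shPow (one1 - c) n) := by
      rw [shPow, ← add_sh, sub_add_cancel, one1_sh]
    rw [Finset.sum_range_succ, sh_add, ih, sub_add, sub_right_inj, sub_eq_iff_eq_add]
    exact h

theorem sh_shInv {c : Ser} (hc : inM c) : sh c (shInv c) = one1 := by
  funext w
  have h0 : (one1 - c) [] = 0 := by rw [Pi.sub_apply, hc]; simp [one1]
  rw [sh_congr fun u hu => shInv_eq_sum hc (Nat.lt_succ_of_le hu), sh_sum_shPow, Pi.sub_apply,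
    shPow_eq_zero h0 _ (Nat.lt_succ_self _), sub_zero]

theorem odot_sMap_iMap (m c : Ser) : odot (sMap m) (iMap c) = (m, sh c m) := by
  simp [odot, sMap, iMap, sh_one1]

/-- the sequence `0 → (ℝ⟨⟨X⟩⟩, +) → (G, ⊙) → (M, ⧢) → 1` is a
split short exact sequence of groups: `i` is an injective homomorphism,
`π₁` is a surjective homomorphism onto `(M, ⧢)` whose kernel is exactly
`G₊ = i(ℝ⟨⟨X⟩⟩) = {(𝟙, c)}` (which is consequently normal in `(G, ⊙)`),
and `s` is a homomorphic section of `π₁`.  Consequently every `g ∈ G`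
factors uniquely as `g = s(m) ⊙ i(c)` with `m ∈ M`, exhibiting `(G, ⊙)` as
the semidirect product `M ⋉ (ℝ⟨⟨X⟩⟩, +)`. -/
theorem split_exact_sequence :
    Function.Injective iMap ∧
    (∀ c d : Ser, iMap (c + d) = odot (iMap c) (iMap d)) ∧
    (∀ g : Ser × Ser, inG g → inM (pi1 g)) ∧
    (∀ g h : Ser × Ser, inG g → inG h → pi1 (odot g h) = sh (pi1 g) (pi1 h)) ∧
    (∀ m : Ser, inM m → ∃ g : Ser × Ser, inG g ∧ pi1 g = m) ∧
    (∀ g : Ser × Ser, inG g → (pi1 g = one1 ↔ ∃ c : Ser, g = iMap c)) ∧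
    (∀ g h : Ser × Ser, inG g → (∃ c : Ser, h = iMap c) →
      ∃ c : Ser, odot (odot g h) (odotInv g) = iMap c) ∧
    (∀ m m' : Ser, inM m → inM m' → sMap (sh m m') = odot (sMap m) (sMap m')) ∧
    (∀ m : Ser, pi1 (sMap m) = m) ∧
    (∀ g : Ser × Ser, inG g →
      ∃! p : Ser × Ser, inM p.1 ∧ g = odot (sMap p.1) (iMap p.2)) := by
  refine ⟨fun c d h => congrArg Prod.snd h, fun c d => ?_, fun g hg => hg,
    fun g h _ _ => rfl, fun m hm => ⟨sMap m, hm, rfl⟩, fun g _ => ⟨fun h => ⟨g.2, ?_⟩, ?_⟩,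
    ?_, fun m m' _ _ => ?_, fun m => rfl, fun g hg => ?_⟩
  · simp [odot, iMap, sh_one1]
  · exact Prod.ext h rfl
  · rintro ⟨c, rfl⟩
    rfl
  · rintro g _ hg ⟨c, rfl⟩
    refine ⟨_, Prod.ext ?_ rfl⟩
    change sh (sh g.1 one1) (shInv g.1) = one1
    rw [sh_one1, sh_shInv hg]
  · simp [odot, sMap, zero_sh]
  · simp only [odot_sMap_iMap]
    refine ⟨(g.1, sh g.2 (shInv g.1)), ⟨hg, Prod.ext rfl ?_⟩, ?_⟩
    · rw [sh_assoc, sh_comm (shInv g.1), sh_shInv hg, sh_one1]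
    · rintro ⟨m, c⟩ ⟨hm, rfl⟩
      simp only [sh_assoc, sh_shInv hm, sh_one1]
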